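/- arXiv:2309.10143 — 2 statements merged into one kernel-verified Lean document; each statement's English description precedes it below -/
import Mathlib

section
/- Let X be a set, Ω a domain on X, K_Ω : Ω → ℝ symmetric, and suppose 𝒞(K_Ω) is nonempty. Then 𝒞(K_Ω) is a singleton if and only if for every (x,y) ∈ (X × X) ∖ Ω and every ε > 0 there exist admissible pairs (M,F) and (M',F') for (x,y) with m_{xy} < 0 and m'_{xy} > 0 such that ℛ_{xy}(M,F) − ℛ_{xy}(M',F') < ε. -/
/-- A reproducing kernel on a set `X`. -/
def IsKernel {X : Type*} (K : X → X → ℝ) : Prop :=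
  (∀ x y, K x y = K y x) ∧
  ∀ (n : ℕ) (α : Fin n → ℝ) (x : Fin n → X),
    0 ≤ ∑ i, ∑ j, α i * α j * K (x i) (x j)

/-- A domain on `X`: a symmetric subset of `X × X` containing the diagonal. -/
def IsCompletionDomain {X : Type*} (Ω : Set (X × X)) : Prop :=
  (∀ x y, (x, y) ∈ Ω ↔ (y, x) ∈ Ω) ∧ ∀ x, (x, x) ∈ Ω

/-- `K` is a completion of `KΩ` on the domain `Ω`. -/
def IsCompletion {X : Type*} (Ω : Set (X × X)) (KΩ : X → X → ℝ) (K : X → X → ℝ) : Prop :=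
  IsKernel K ∧ ∀ x y, (x, y) ∈ Ω → K x y = KΩ x y

/-- An admissible pair `(M, F)` for the point `(x, y) ∉ Ω`. -/
def Admissible {X : Type*} (Ω : Set (X × X)) (x y : X) (F : Finset X)
    (M : Matrix ↥F ↥F ℝ) : Prop :=
  M.PosSemidef ∧
    ∀ u v : ↥F, ((u : X), (v : X)) ∉ Ω ∪ {(x, y), (y, x)} → M u v = 0

open scoped Classical in
/-- The quantity `ℛ_{xy}(M, F)`. -/
noncomputable def Rval {X : Type*} (Ω : Set (X × X)) (KΩ : X → X → ℝ)
    (F : Finset X) (M : Matrix ↥F ↥F ℝ) (a b : ↥F) : ℝ :=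
  -(1 / (2 * M a b)) * ∑ u : ↥F, ∑ v : ↥F,
    if ((u : X), (v : X)) ∈ Ω then M u v * KΩ u v else 0

open Matrix in
lemma posSemidef_iff_symm_and_sum_nonneg {ι : Type*} [Fintype ι] {M : Matrix ι ι ℝ} :
    M.PosSemidef ↔ (∀ i j, M i j = M j i) ∧ ∀ α : ι → ℝ, 0 ≤ ∑ i, ∑ j, M i j * (α i * α j) := by
  rw [posSemidef_iff_dotProduct_mulVec]
  refine and_congr ⟨fun h i j => ?_, fun h => ?_⟩ (forall_congr' fun α => ?_)
  · simpa using (h.apply i j).symm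
  · ext i j
    simpa using h j i
  · simp only [dotProduct, mulVec, star_trivial, Finset.mul_sum]
    simp only [mul_left_comm]

lemma IsKernel.posSemidef {X ι : Type*} [Fintype ι] {K : X → X → ℝ} (hK : IsKernel K)
    (p : ι → X) : (Matrix.of fun i j => K (p i) (p j)).PosSemidef := by
  refine posSemidef_iff_symm_and_sum_nonneg.2 ⟨fun i j => hK.1 _ _, fun α => ?_⟩
  let e := Fintype.equivFin ι
  have h := hK.2 _ (α ∘ e.symm) (p ∘ e.symm)
  refine h.trans_eq ((e.symm.sum_comp
    fun i => ∑ j, α i * α (e.symm j) * K (p i) (p (e.symm j))).trans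
    (Finset.sum_congr rfl fun i _ => ?_))
  refine (e.symm.sum_comp fun j => α i * α j * K (p i) (p j)).trans ?_
  exact Finset.sum_congr rfl fun j _ => mul_comm _ _

lemma IsKernel.sum_mul_nonneg {X ι : Type*} [Fintype ι] {K : X → X → ℝ} (hK : IsKernel K)
    (p : ι → X) {M : Matrix ι ι ℝ} (hM : M.PosSemidef) :
    0 ≤ ∑ i, ∑ j, M i j * K (p i) (p j) := by
  simpa using (posSemidef_iff_symm_and_sum_nonneg.1 (hM.hadamard (hK.posSemidef p))).2 1

/-- Pairing an admissible matrix with a symmetric extension of the data separates the entries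
over `Ω` from the entry at `(x, y)`. -/
lemma Admissible.sum_mul_eq {X : Type*} {Ω : Set (X × X)} (hΩ : IsCompletionDomain Ω)
    {KΩ K : X → X → ℝ} (hsymm : ∀ u v, K u v = K v u)
    (hK : ∀ u v, (u, v) ∈ Ω → K u v = KΩ u v) {x y : X} (hxy : (x, y) ∉ Ω) {F : Finset X}
    (hx : x ∈ F) (hy : y ∈ F) {M : Matrix ↥F ↥F ℝ} (hM : Admissible Ω x y F M) :
    open scoped Classical in
    ∑ u : ↥F, ∑ v : ↥F, M u v * K u v =
      (∑ u : ↥F, ∑ v : ↥F, if ((u : X), (v : X)) ∈ Ω then M u v * KΩ u v else 0) +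
        2 * M ⟨x, hx⟩ ⟨y, hy⟩ * K x y := by
  classical
  have hyx : (y, x) ∉ Ω := fun h => hxy ((hΩ.1 x y).2 h)
  have hne : x ≠ y := fun h => hxy (h ▸ hΩ.2 x)
  have hMs := (posSemidef_iff_symm_and_sum_nonneg.1 hM.1).1
  have key : ∀ u v : ↥F, M u v * K u v =
      (if ((u : X), (v : X)) ∈ Ω then M u v * KΩ u v else 0) +
        ((if u = ⟨x, hx⟩ then if v = ⟨y, hy⟩ then M ⟨x, hx⟩ ⟨y, hy⟩ * K x y else 0 else 0) +
        (if u = ⟨y, hy⟩ then if v = ⟨x, hx⟩ then M ⟨x, hx⟩ ⟨y, hy⟩ * K x y else 0 else 0)) := by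
    intro u v
    by_cases h1 : ((u : X), (v : X)) ∈ Ω
    · have h2 : ¬ (u = ⟨x, hx⟩ ∧ v = ⟨y, hy⟩) := by rintro ⟨rfl, rfl⟩; exact hxy h1
      have h3 : ¬ (u = ⟨y, hy⟩ ∧ v = ⟨x, hx⟩) := by rintro ⟨rfl, rfl⟩; exact hyx h1
      rw [← ite_and, ← ite_and, if_pos h1, if_neg h2, if_neg h3, hK _ _ h1]
      simp
    · rw [if_neg h1, ← ite_and, ← ite_and]
      by_cases h2 : u = ⟨x, hx⟩ ∧ v = ⟨y, hy⟩
      · obtain ⟨rfl, rfl⟩ := h2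
        simp [hne]
      · by_cases h3 : u = ⟨y, hy⟩ ∧ v = ⟨x, hx⟩
        · obtain ⟨rfl, rfl⟩ := h3
          simp [hne.symm, hMs ⟨y, hy⟩ ⟨x, hx⟩, hsymm y x]
        · rw [if_neg h2, if_neg h3, hM.2 u v]
          · simp
          · simp only [Subtype.ext_iff] at h2 h3
            simp [h1, h2, h3]
  rw [Finset.sum_congr rfl fun u _ => Finset.sum_congr rfl fun v _ => key u v]
  simp only [Finset.sum_add_distrib, Finset.sum_ite_irrel, Finset.sum_ite_eq', Finset.sum_const_zero,
    Finset.mem_univ, if_true]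
  ring

lemma Admissible.sum_mul_eq_sub_Rval {X : Type*} {Ω : Set (X × X)} (hΩ : IsCompletionDomain Ω)
    {KΩ K : X → X → ℝ} (hsymm : ∀ u v, K u v = K v u)
    (hK : ∀ u v, (u, v) ∈ Ω → K u v = KΩ u v) {x y : X} (hxy : (x, y) ∉ Ω) {F : Finset X}
    (hx : x ∈ F) (hy : y ∈ F) {M : Matrix ↥F ↥F ℝ} (hM : Admissible Ω x y F M)
    (h0 : M ⟨x, hx⟩ ⟨y, hy⟩ ≠ 0) :
    ∑ u : ↥F, ∑ v : ↥F, M u v * K u v =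
      2 * M ⟨x, hx⟩ ⟨y, hy⟩ * (K x y - Rval Ω KΩ F M ⟨x, hx⟩ ⟨y, hy⟩) := by
  rw [hM.sum_mul_eq hΩ hsymm hK hxy hx hy, Rval]
  field_simp
  ring

section
variable {X : Type*} {Ω : Set (X × X)} {KΩ K : X → X → ℝ} {x y : X} {F : Finset X}
  {M : Matrix ↥F ↥F ℝ}

lemma IsCompletion.Rval_le (hK : IsCompletion Ω KΩ K) (hΩ : IsCompletionDomain Ω)
    (hxy : (x, y) ∉ Ω) (hM : Admissible Ω x y F M) (hx : x ∈ F) (hy : y ∈ F)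
    (hpos : 0 < M ⟨x, hx⟩ ⟨y, hy⟩) : Rval Ω KΩ F M ⟨x, hx⟩ ⟨y, hy⟩ ≤ K x y := by
  have h := hK.1.sum_mul_nonneg (fun u : ↥F => (u : X)) hM.1
  rw [hM.sum_mul_eq_sub_Rval hΩ hK.1.1 hK.2 hxy hx hy hpos.ne'] at h
  exact sub_nonneg.1 (nonneg_of_mul_nonneg_right h (by positivity))

lemma IsCompletion.le_Rval (hK : IsCompletion Ω KΩ K) (hΩ : IsCompletionDomain Ω)
    (hxy : (x, y) ∉ Ω) (hM : Admissible Ω x y F M) (hx : x ∈ F) (hy : y ∈ F)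
    (hneg : M ⟨x, hx⟩ ⟨y, hy⟩ < 0) : K x y ≤ Rval Ω KΩ F M ⟨x, hx⟩ ⟨y, hy⟩ := by
  have h := hK.1.sum_mul_nonneg (fun u : ↥F => (u : X)) hM.1
  rw [hM.sum_mul_eq_sub_Rval hΩ hK.1.1 hK.2 hxy hx hy hneg.ne] at h
  nlinarith

end

/-- Finitely supported (not necessarily symmetric) matrices with nonnegative quadratic form. -/
noncomputable def finsuppPosCone (X : Type*) : PointedCone ℝ (X × X →₀ ℝ) where
  carrier := {M | ∀ α : X → ℝ, 0 ≤ Finsupp.linearCombination ℝ (fun p => α p.1 * α p.2) M}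
  add_mem' hM hN α := by
    rw [map_add]
    exact add_nonneg (hM α) (hN α)
  zero_mem' α := by simp
  smul_mem' c M hM α := by
    have := mul_nonneg c.2 (hM α)
    rwa [← smul_eq_mul, ← map_smul] at this

lemma mem_finsuppPosCone {X : Type*} {M : X × X →₀ ℝ} : M ∈ finsuppPosCone X ↔
    ∀ α : X → ℝ, 0 ≤ Finsupp.linearCombination ℝ (fun p => α p.1 * α p.2) M := Iff.rfl

lemma exists_supported_add_mem_finsuppPosCone {X : Type*} {s : Set (X × X)}
    (hs : ∀ x, (x, x) ∈ s) (M : X × X →₀ ℝ) :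
    ∃ D ∈ Finsupp.supported ℝ ℝ s, D + M ∈ finsuppPosCone X := by
  induction M using Finsupp.induction_linear with
  | zero => exact ⟨0, zero_mem _, by simp⟩
  | add M N hM hN =>
    obtain ⟨D, hD, hDM⟩ := hM
    obtain ⟨E, hE, hEN⟩ := hN
    exact ⟨D + E, add_mem hD hE, by rw [add_add_add_comm]; exact add_mem hDM hEN⟩
  | single p m =>
    refine ⟨Finsupp.single (p.1, p.1) |m| + Finsupp.single (p.2, p.2) |m|,
      add_mem (Finsupp.single_mem_supported _ _ (hs _))
        (Finsupp.single_mem_supported _ _ (hs _)), fun α => ?_⟩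
    simp only [map_add, Finsupp.linearCombination_single, smul_eq_mul]
    nlinarith [neg_abs_le m, le_abs_self m, sq_nonneg (α p.1 + α p.2), sq_nonneg (α p.1 - α p.2),
      mul_nonneg (sub_nonneg.2 (le_abs_self m)) (sq_nonneg (α p.1 - α p.2)),
      mul_nonneg (sub_nonneg.2 (neg_abs_le m)) (sq_nonneg (α p.1 + α p.2)),
      mul_nonneg (abs_nonneg m) (add_nonneg (sq_nonneg (α p.1)) (sq_nonneg (α p.2)))]

/-- A functional that is nonnegative on the positive cone is integration against a kernel. -/
lemma isKernel_of_nonneg_on_finsuppPosCone {X : Type*} {g : (X × X →₀ ℝ) →ₗ[ℝ] ℝ}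
    (hg : ∀ M ∈ finsuppPosCone X, 0 ≤ g M) :
    IsKernel fun x y => g (Finsupp.single (x, y) 1) := by
  have le : ∀ x y, g (Finsupp.single (x, y) 1) ≤ g (Finsupp.single (y, x) 1) := by
    intro x y
    rw [← sub_nonneg, ← map_sub]
    refine hg _ fun α => ?_
    simp [mul_comm]
  refine ⟨fun x y => (le x y).antisymm (le y x), fun n α x => ?_⟩
  have h := hg (∑ i, ∑ j, (α i * α j) • Finsupp.single (x i, x j) 1) fun β => ?_
  · simpa only [map_sum, map_smul, smul_eq_mul] using h
  · have : 0 ≤ (∑ i, α i * β (x i)) * ∑ i, α i * β (x i) := mul_self_nonneg _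
    rw [Finset.sum_mul_sum] at this
    simpa only [map_sum, map_smul, Finsupp.linearCombination_single, smul_eq_mul, one_mul,
      mul_mul_mul_comm] using this

lemma linearCombination_eq_sum_subtype {X : Type*} {F : Finset X} {M : X × X →₀ ℝ}
    (hF : M.support ⊆ F ×ˢ F) {w : X → X → ℝ} :
    Finsupp.linearCombination ℝ (fun p => w p.1 p.2) M =
      ∑ u : ↥F, ∑ v : ↥F, M (u, v) * w u v := by
  rw [Finsupp.linearCombination_apply, Finsupp.sum_of_support_subset _ hF _ (by simp),
    Finset.sum_product]
  simp only [smul_eq_mul]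
  rw [← Finset.sum_coe_sort F]
  exact Finset.sum_congr rfl fun u _ => (Finset.sum_coe_sort F _).symm

/-- Elements of the cone supported on `Ω` and `(x, y)`, `(y, x)` come from admissible matrices. -/
lemma exists_admissible_of_mem_finsuppPosCone {X : Type*} {Ω : Set (X × X)}
    (hΩ : IsCompletionDomain Ω) (x y : X) {M : X × X →₀ ℝ}
    (hM : M ∈ Finsupp.supported ℝ ℝ (Ω ∪ {(x, y), (y, x)})) (hpos : M ∈ finsuppPosCone X) :
    ∃ (F : Finset X) (_ : x ∈ F) (_ : y ∈ F) (N : Matrix ↥F ↥F ℝ), Admissible Ω x y F N ∧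
      ∀ w : X → X → ℝ, (∀ u v, w u v = w v u) →
        Finsupp.linearCombination ℝ (fun p => w p.1 p.2) M = ∑ u : ↥F, ∑ v : ↥F, N u v * w u v := by
  classical
  let F : Finset X := {x, y} ∪ (M.support.image Prod.fst ∪ M.support.image Prod.snd)
  have hF : M.support ⊆ F ×ˢ F := by
    intro p hp
    have h1 := Finset.mem_image_of_mem Prod.fst hp
    have h2 := Finset.mem_image_of_mem Prod.snd hp
    simp only [F, Finset.mem_product, Finset.mem_union]
    tauto
  let N : Matrix ↥F ↥F ℝ := Matrix.of fun u v => (M (u, v) + M (v, u)) / 2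
  have hN : ∀ w : X → X → ℝ, (∀ u v, w u v = w v u) →
      Finsupp.linearCombination ℝ (fun p => w p.1 p.2) M =
        ∑ u : ↥F, ∑ v : ↥F, N u v * w u v := by
    intro w hw
    have hswap : ∑ u : ↥F, ∑ v : ↥F, M (v, u) * w u v = ∑ u : ↥F, ∑ v : ↥F, M (u, v) * w u v := by
      rw [Finset.sum_comm]
      exact Finset.sum_congr rfl fun u _ => Finset.sum_congr rfl fun v _ => by rw [hw]
    have hsplit : ∀ u v : ↥F, N u v * w u v = (M (u, v) * w u v + M (v, u) * w u v) / 2 :=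
      fun u v => by simp only [N, Matrix.of_apply]; ring
    simp only [hsplit, ← Finset.sum_div, Finset.sum_add_distrib, hswap]
    rw [linearCombination_eq_sum_subtype hF]
    ring
  have hzero : ∀ u v : X, (u, v) ∉ Ω ∪ {(x, y), (y, x)} → M (u, v) = 0 := fun u v huv =>
    Finsupp.notMem_support_iff.1 fun h => huv ((Finsupp.mem_supported _ _).1 hM h)
  refine ⟨F, by simp [F], by simp [F], N, ⟨posSemidef_iff_symm_and_sum_nonneg.2
    ⟨fun u v => by simp [N, add_comm], fun α => ?_⟩, fun u v huv => ?_⟩, hN⟩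
  · let β : X → ℝ := fun u => if h : u ∈ F then α ⟨u, h⟩ else 0
    have h := hpos β
    rw [hN (fun u v => β u * β v) fun u v => mul_comm _ _] at h
    simpa [β] using h
  · have hvu : ((v : X), (u : X)) ∉ Ω ∪ {(x, y), (y, x)} := by
      have := hΩ.1 u v
      simp only [Set.mem_union, Set.mem_insert_iff, Set.mem_singleton_iff, Prod.mk.injEq] at huv ⊢
      tauto
    simp [N, hzero _ _ huv, hzero _ _ hvu]

/-- Every value compatible with the bounds `Rval` is attained at `(x, y)` by a completion. -/
lemma exists_isCompletion_apply_eq {X : Type*} {Ω : Set (X × X)} (hΩ : IsCompletionDomain Ω)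
    {KΩ K₀ : X → X → ℝ} (hK₀ : IsCompletion Ω KΩ K₀) {x y : X} (hxy : (x, y) ∉ Ω) (a : ℝ)
    (hle : ∀ (F : Finset X) (hx : x ∈ F) (hy : y ∈ F) (M : Matrix ↥F ↥F ℝ),
      Admissible Ω x y F M → 0 < M ⟨x, hx⟩ ⟨y, hy⟩ → Rval Ω KΩ F M ⟨x, hx⟩ ⟨y, hy⟩ ≤ a)
    (hge : ∀ (F : Finset X) (hx : x ∈ F) (hy : y ∈ F) (M : Matrix ↥F ↥F ℝ),
      Admissible Ω x y F M → M ⟨x, hx⟩ ⟨y, hy⟩ < 0 → a ≤ Rval Ω KΩ F M ⟨x, hx⟩ ⟨y, hy⟩) :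
    ∃ K, IsCompletion Ω KΩ K ∧ K x y = a := by
  classical
  let w : X → X → ℝ := fun u v => if (u, v) ∈ Ω then K₀ u v else a
  have hw : ∀ u v, w u v = w v u := fun u v => by simp only [w, hΩ.1 u v, hK₀.1.1 u v]
  have hwΩ : ∀ u v, (u, v) ∈ Ω → w u v = KΩ u v := fun u v h => by simp [w, h, hK₀.2 u v h]
  have hwxy : w x y = a := if_neg hxy
  let S := Finsupp.supported ℝ ℝ (Ω ∪ {(x, y), (y, x)})
  let L := Finsupp.linearCombination ℝ fun p : X × X => w p.1 p.2
  obtain ⟨g, hgS, hg⟩ := riesz_extension (finsuppPosCone X) ⟨S, L.comp S.subtype⟩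
    (fun M hM => by
      obtain ⟨F, hx, hy, N, hN, hLN⟩ := exists_admissible_of_mem_finsuppPosCone hΩ x y M.2 hM
      change 0 ≤ L M
      rw [hLN w hw]
      rcases lt_trichotomy (N ⟨x, hx⟩ ⟨y, hy⟩) 0 with h | h | h
      · rw [hN.sum_mul_eq_sub_Rval hΩ hw hwΩ hxy hx hy h.ne, hwxy]
        nlinarith [hge F hx hy N hN h]
      · have h₀ := hK₀.1.sum_mul_nonneg (fun u : ↥F => (u : X)) hN.1
        rw [hN.sum_mul_eq hΩ hK₀.1.1 hK₀.2 hxy hx hy, h] at h₀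
        rw [hN.sum_mul_eq hΩ hw hwΩ hxy hx hy, h]
        simpa using h₀
      · rw [hN.sum_mul_eq_sub_Rval hΩ hw hwΩ hxy hx hy h.ne', hwxy]
        nlinarith [hle F hx hy N hN h])
    (fun M => by
      obtain ⟨D, hD, hDM⟩ := exists_supported_add_mem_finsuppPosCone
        (s := Ω ∪ {(x, y), (y, x)}) (fun u => Or.inl (hΩ.2 u)) M
      exact ⟨⟨D, hD⟩, hDM⟩)
  have hgw : ∀ u v, (u, v) ∈ Ω ∪ {(x, y), (y, x)} → g (Finsupp.single (u, v) 1) = w u v := by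
    intro u v huv
    refine (hgS ⟨_, Finsupp.single_mem_supported ℝ 1 huv⟩).trans ?_
    change L (Finsupp.single (u, v) 1) = w u v
    simp [L]
  exact ⟨_, ⟨isKernel_of_nonneg_on_finsuppPosCone hg,
    fun u v huv => (hgw u v (Or.inl huv)).trans (hwΩ u v huv)⟩,
    (hgw x y (by simp)).trans hwxy⟩

/-- The completion is unique iff for every `(x,y) ∉ Ω` and `ε > 0` there are admissible pairs
with `m_{xy} < 0` and `m'_{xy} > 0` whose `ℛ` values are within `ε` of each other. -/
theorem completion_unique_iff {X : Type*}
    (Ω : Set (X × X)) (hΩ : IsCompletionDomain Ω) (KΩ : X → X → ℝ)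
    (hsymm : ∀ u v, (u, v) ∈ Ω → KΩ u v = KΩ v u)
    (hne : ∃ K : X → X → ℝ, IsCompletion Ω KΩ K) :
    (∃ K : X → X → ℝ, {K' | IsCompletion Ω KΩ K'} = {K}) ↔
      ∀ x y : X, (x, y) ∉ Ω → ∀ ε : ℝ, 0 < ε →
        ∃ (F : Finset X) (hx : x ∈ F) (hy : y ∈ F) (M : Matrix ↥F ↥F ℝ)
          (F' : Finset X) (hx' : x ∈ F') (hy' : y ∈ F') (M' : Matrix ↥F' ↥F' ℝ),
          Admissible Ω x y F M ∧ Admissible Ω x y F' M' ∧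
          M ⟨x, hx⟩ ⟨y, hy⟩ < 0 ∧ 0 < M' ⟨x, hx'⟩ ⟨y, hy'⟩ ∧
          Rval Ω KΩ F M ⟨x, hx⟩ ⟨y, hy⟩ - Rval Ω KΩ F' M' ⟨x, hx'⟩ ⟨y, hy'⟩ < ε := by
  constructor
  · rintro ⟨K, hK⟩ x y hxy ε hε
    have hKc : IsCompletion Ω KΩ K := by
      have : K ∈ {K' | IsCompletion Ω KΩ K'} := hK ▸ rfl
      exact this
    have huniq : ∀ K', IsCompletion Ω KΩ K' → K' x y = K x y := fun K' hK' => by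
      have : K' ∈ ({K} : Set (X → X → ℝ)) := hK ▸ hK'
      rw [Set.mem_singleton_iff.1 this]
    obtain ⟨F, hx, hy, M, hM, hneg, hlt⟩ : ∃ (F : Finset X) (hx : x ∈ F) (hy : y ∈ F)
        (M : Matrix ↥F ↥F ℝ), Admissible Ω x y F M ∧ M ⟨x, hx⟩ ⟨y, hy⟩ < 0 ∧
          Rval Ω KΩ F M ⟨x, hx⟩ ⟨y, hy⟩ < K x y + ε / 2 := by
      by_contra! h
      obtain ⟨K', hK', hval⟩ := exists_isCompletion_apply_eq hΩ hKc hxy (K x y + ε / 2)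
        (fun F hx hy M hM hpos => (hKc.Rval_le hΩ hxy hM hx hy hpos).trans (by linarith)) h
      linarith [huniq K' hK']
    obtain ⟨F', hx', hy', M', hM', hpos, hgt⟩ : ∃ (F : Finset X) (hx : x ∈ F) (hy : y ∈ F)
        (M : Matrix ↥F ↥F ℝ), Admissible Ω x y F M ∧ 0 < M ⟨x, hx⟩ ⟨y, hy⟩ ∧
          K x y - ε / 2 < Rval Ω KΩ F M ⟨x, hx⟩ ⟨y, hy⟩ := by
      by_contra! h
      obtain ⟨K', hK', hval⟩ := exists_isCompletion_apply_eq hΩ hKc hxy (K x y - ε / 2) h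
        (fun F hx hy M hM hneg => le_trans (by linarith) (hKc.le_Rval hΩ hxy hM hx hy hneg))
      linarith [huniq K' hK']
    exact ⟨F, hx, hy, M, F', hx', hy', M', hM, hM', hneg, hpos, by linarith⟩
  · intro h
    obtain ⟨K, hK⟩ := hne
    have hle : ∀ K₁ K₂, IsCompletion Ω KΩ K₁ → IsCompletion Ω KΩ K₂ → ∀ x y, K₁ x y ≤ K₂ x y := by
      intro K₁ K₂ h₁ h₂ x y
      by_cases hxy : (x, y) ∈ Ω
      · rw [h₁.2 x y hxy, h₂.2 x y hxy]
      · refine le_of_forall_pos_le_add fun ε hε => ?_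
        obtain ⟨F, hx, hy, M, F', hx', hy', M', hM, hM', hneg, hpos, hlt⟩ := h x y hxy ε hε
        linarith [h₁.le_Rval hΩ hxy hM hx hy hneg, h₂.Rval_le hΩ hxy hM' hx' hy' hpos]
    refine ⟨K, Set.eq_singleton_iff_unique_mem.2 ⟨hK, fun K' hK' => ?_⟩⟩
    funext x y
    exact (hle K' K hK' hK x y).antisymm (hle K K' hK hK' x y)
end

section
/- Let a > 0 and let F : ℝ → ℝ be positive-definite on (−a, a). Then there exists a function F̃ : ℝ → ℝ that is positive-definite on (−2a, 2a) and satisfies F̃(t) = F(t) for all t ∈ (−a, a). -/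
/-- `F` is positive-definite on the symmetric set `I ⊆ ℝ`. -/
def IsPosDefOn (I : Set ℝ) (F : ℝ → ℝ) : Prop :=
  ∀ (n : ℕ) (x : Fin n → ℝ) (α : Fin n → ℝ),
    (∀ i j, x i - x j ∈ I) →
    0 ≤ ∑ i, ∑ j, α i * α j * F (x i - x j)

/-- `f` is represented on the integers of absolute value less than `N` as the Gram matrix of a
stationary family of `N` vectors in a real inner product space. -/
def IsToeplitzGram (f : ℤ → ℝ) (N : ℕ) : Prop :=
  ∃ (E : Type) (_ : NormedAddCommGroup E) (_ : InnerProductSpace ℝ E) (e : ℕ → E),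
    ∀ i < N, ∀ j < N, inner ℝ (e i) (e j) = f ((i : ℤ) - j)

open scoped MatrixOrder Matrix in
theorem isToeplitzGram_of_forall_sum_nonneg {f : ℤ → ℝ} (hf : ∀ d, f (-d) = f d) (N : ℕ)
    (h : ∀ α : Fin N → ℝ, 0 ≤ ∑ i, ∑ j, α i * α j * f ((i : ℤ) - (j : ℤ))) :
    IsToeplitzGram f N := by
  let A : Matrix (Fin N) (Fin N) ℝ := Matrix.of fun i j => f ((i : ℤ) - (j : ℤ))
  have hA : A.PosSemidef := by
    refine Matrix.PosSemidef.of_dotProduct_mulVec_nonneg ?_ fun α => ?_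
    · refine Matrix.IsHermitian.ext fun i j => ?_
      change f _ = f _
      rw [← hf, neg_sub]
    · have key : star α ⬝ᵥ A *ᵥ α = ∑ i, ∑ j, α i * α j * f ((i : ℤ) - (j : ℤ)) := by
        simp only [dotProduct, Matrix.mulVec, Finset.mul_sum, A, Matrix.of_apply, Pi.star_apply,
          star_trivial]
        exact Finset.sum_congr rfl fun i _ => Finset.sum_congr rfl fun j _ => by ring
      rw [key]
      exact h α
  obtain ⟨B, hB⟩ := CStarAlgebra.nonneg_iff_eq_star_mul_self.mp hA.nonneg
  refine ⟨EuclideanSpace ℝ (Fin N), inferInstance, inferInstance,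
    fun i => if hi : i < N then WithLp.toLp 2 fun k => B k ⟨i, hi⟩ else 0, fun i hi j hj => ?_⟩
  have := congrFun (congrFun hB ⟨i, hi⟩) ⟨j, hj⟩
  simp only [A, Matrix.of_apply, Matrix.star_eq_conjTranspose, Matrix.mul_apply,
    Matrix.conjTranspose_apply, star_trivial] at this
  beta_reduce
  rw [dif_pos hi, dif_pos hj, this, PiLp.inner_apply]
  exact Finset.sum_congr rfl fun k _ => by simp [mul_comm]

/-- A positive-definite function on `(-N, N) ∩ ℤ` extends to one on `(-(N + 1), N + 1) ∩ ℤ`. -/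
theorem IsToeplitzGram.exists_succ {f : ℤ → ℝ} (hf : ∀ d, f (-d) = f d) {N : ℕ} (hN : 0 < N)
    (h : IsToeplitzGram f N) :
    ∃ g : ℤ → ℝ, (∀ d, g (-d) = g d) ∧ (∀ d : ℤ, |d| < N → g d = f d) ∧
      IsToeplitzGram g (N + 1) := by
  obtain ⟨n, rfl⟩ : ∃ n, N = n + 1 := ⟨N - 1, by omega⟩
  obtain ⟨E, _, _, e, he⟩ := h
  let w : Fin n → E := fun i => e (i + 1)
  have : FiniteDimensional ℝ (Submodule.span ℝ (Set.range w)) :=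
    FiniteDimensional.span_of_finite ℝ (Set.finite_range w)
  obtain ⟨u, hu, z, hz, huz⟩ :=
    Submodule.exists_add_mem_mem_orthogonal (K := Submodule.span ℝ (Set.range w)) (e 0)
  obtain ⟨l, rfl⟩ := (Submodule.mem_span_range_iff_exists_fun ℝ).mp hu
  have hzw (i : Fin n) : inner ℝ z (w i) = 0 := by
    rw [real_inner_comm]; exact hz _ (Submodule.subset_span ⟨i, rfl⟩)
  let v : E := ∑ i, l i • e (n - i)
  have hve (j : ℕ) (hj : j < n) : inner ℝ v (e (j + 1)) = f ((n : ℤ) + 1 - (j + 1 : ℕ)) := by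
    have h1 : inner ℝ (e 0) (e (n - j)) = f (-(n - j : ℕ)) := by
      simpa using he 0 (by omega) (n - j) (by omega)
    have h2 : inner ℝ z (e (n - j)) = 0 := by
      have := hzw ⟨n - j - 1, by omega⟩
      simpa only [w, show n - j - 1 + 1 = n - j by omega] using this
    rw [huz, inner_add_left, h2, add_zero, sum_inner, hf] at h1
    rw [sum_inner, show (n : ℤ) + 1 - (j + 1 : ℕ) = (n - j : ℕ) by push_cast [hj.le]; ring, ← h1]
    refine Finset.sum_congr rfl fun i _ => ?_
    rw [real_inner_smul_left, real_inner_smul_left, he _ (by omega) _ (by omega),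
      he _ (by omega) _ (by omega), ← hf]
    congr 2
    have := i.2
    omega
  have hvv : inner ℝ v v = inner ℝ (∑ i, l i • w i) (∑ i, l i • w i) := by
    simp only [v, w, sum_inner, inner_sum, real_inner_smul_left, real_inner_smul_right]
    refine Finset.sum_congr rfl fun i _ => Finset.sum_congr rfl fun j _ => ?_
    rw [he _ (by omega) _ (by omega), he _ (by omega) _ (by omega), ← hf]
    congr 3
    have := i.2
    have := j.2
    omega
  have hle : inner ℝ v v ≤ f 0 := by
    have h0 : inner ℝ (e 0) (e 0) = f 0 := by simpa using he 0 (by omega) 0 (by omega)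
    have h3 : inner ℝ z (∑ i, l i • w i) = 0 := by
      simp [inner_sum, real_inner_smul_right, hzw]
    rw [huz, inner_add_left, inner_add_right, inner_add_right, h3, real_inner_comm z, h3] at h0
    rw [hvv, ← h0]
    have : 0 ≤ inner ℝ z z := real_inner_self_nonneg
    linarith
  let c := inner ℝ v (e 0)
  let g : ℤ → ℝ := fun d => if |d| = n + 1 then c else f d
  have hg (d : ℤ) : g (-d) = g d := by simp only [g, abs_neg, hf]
  have hgf (d : ℤ) (hd : |d| < (n + 1 : ℕ)) : g d = f d := if_neg (by push_cast at hd; omega)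
  let E' := WithLp 2 (E × ℝ)
  let last : E' := WithLp.toLp 2 (v, √(f 0 - inner ℝ v v))
  have hlast (j : ℕ) (hj : j < n + 1) : inner ℝ v (e j) = g ((n + 1 : ℕ) - j) := by
    rcases j with _ | j
    · simp only [g]
      rw [if_pos]
      push_cast
      rw [sub_zero, abs_of_nonneg (by omega)]
    · rw [hve j (by omega), hgf]
      · push_cast; rfl
      · rw [abs_lt]; omega
  refine ⟨g, hg, hgf, E', inferInstance, inferInstance,
    fun i => if i < n + 1 then WithLp.toLp 2 (e i, 0) else last, fun i hi j hj => ?_⟩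
  beta_reduce
  rcases Nat.lt_succ_iff_lt_or_eq.mp hi with hi | rfl <;>
    rcases Nat.lt_succ_iff_lt_or_eq.mp hj with hj | rfl
  · rw [if_pos hi, if_pos hj, WithLp.prod_inner_apply, hgf _ (by rw [abs_lt]; omega)]
    simpa using he i hi j hj
  · rw [if_pos hi, if_neg (lt_irrefl _), WithLp.prod_inner_apply, ← hg, neg_sub, ← hlast i hi]
    simp [last, real_inner_comm]
  · rw [if_pos hj, if_neg (lt_irrefl _), WithLp.prod_inner_apply, ← hlast j hj]
    simp [last]
  · rw [if_neg (lt_irrefl _), WithLp.prod_inner_apply, sub_self, hgf _ (by simp)]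
    have h4 := Real.mul_self_sqrt (sub_nonneg.mpr hle)
    change inner ℝ v v + inner ℝ (√(f 0 - inner ℝ v v)) (√(f 0 - inner ℝ v v)) = f 0
    rw [real_inner_eq_re_inner, RCLike.inner_apply]
    simp only [conj_trivial, RCLike.re_to_real]
    linarith

/-- A positive-definite function on `(-N, N) ∩ ℤ` extends to arbitrarily long intervals of `ℤ`. -/
theorem IsToeplitzGram.exists_extension {f : ℤ → ℝ} (hf : ∀ d, f (-d) = f d) {N : ℕ} (hN : 0 < N)
    (h : IsToeplitzGram f N) (k : ℕ) :
    ∃ g : ℤ → ℝ, (∀ d, g (-d) = g d) ∧ (∀ d : ℤ, |d| < N → g d = f d) ∧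
      IsToeplitzGram g (N + k) := by
  induction k with
  | zero => exact ⟨f, hf, fun _ _ => rfl, h⟩
  | succ k ih =>
    obtain ⟨g, hg, hgf, hgram⟩ := ih
    obtain ⟨g', hg', hgf', hgram'⟩ := hgram.exists_succ hg (by omega)
    exact ⟨g', hg', fun d hd => (hgf' d (by omega)).trans (hgf d hd), hgram'⟩

theorem IsToeplitzGram.sum_nonneg {f : ℤ → ℝ} {N : ℕ} (h : IsToeplitzGram f N) {ι : Type*}
    [Fintype ι] (p : ι → ℤ) (b : ℤ) (hb : ∀ i, 0 ≤ p i + b) (hN : ∀ i, p i + b < N) (α : ι → ℝ) :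
    0 ≤ ∑ i, ∑ j, α i * α j * f (p i - p j) := by
  obtain ⟨E, _, _, e, he⟩ := h
  have key : ∑ i, ∑ j, α i * α j * f (p i - p j) =
      inner ℝ (∑ i, α i • e (p i + b).toNat) (∑ i, α i • e (p i + b).toNat) := by
    simp only [sum_inner, inner_sum, real_inner_smul_left, real_inner_smul_right]
    refine Finset.sum_congr rfl fun i _ => Finset.sum_congr rfl fun j _ => ?_
    have := hb i
    have := hb j
    have := hN i
    have := hN j
    rw [real_inner_comm, he _ (by omega) _ (by omega), mul_assoc]
    congr 3
    omega
  rw [key]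
  exact real_inner_self_nonneg

theorem sum_rotate {ι κ μ M : Type*} [AddCommMonoid M] (A : Finset ι) (B : Finset κ)
    (C : Finset μ) (f : ι → κ → μ → M) :
    ∑ a ∈ A, ∑ b ∈ B, ∑ c ∈ C, f a b c = ∑ b ∈ B, ∑ c ∈ C, ∑ a ∈ A, f a b c := by
  rw [Finset.sum_comm]
  exact Finset.sum_congr rfl fun b _ => Finset.sum_comm

theorem IsPosDefOn.sum_finset_nonneg {I : Set ℝ} {F : ℝ → ℝ} (hF : IsPosDefOn I F) {ι : Type*}
    (S : Finset ι) (x : ι → ℝ) (hx : ∀ s ∈ S, ∀ t ∈ S, x s - x t ∈ I) (c : ι → ℝ) :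
    0 ≤ ∑ s ∈ S, ∑ t ∈ S, c s * c t * F (x s - x t) := by
  let φ := S.equivFin.symm
  have h := hF S.card (fun i => x (φ i)) (fun i => c (φ i))
    fun i j => hx _ (φ i).2 _ (φ j).2
  have key (G : S → ℝ) : ∑ i, G (φ i) = ∑ s, G s := Equiv.sum_comp φ G
  rw [key fun s => ∑ j, c s * c (φ j) * F (x s - x (φ j))] at h
  simp only [fun s : S => key fun t => c s * c t * F (x s - x t)] at h
  rw [← Finset.sum_coe_sort]
  convert h using 2 with s
  exact (Finset.sum_coe_sort S fun t => c s * c t * F (x s - x t)).symm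

theorem sum_ite_sub_eq_neg {F : ℝ → ℝ} (hFe : ∀ t, F (-t) = F t) {ι : Type*} (S : Finset ι)
    (x : ι → ℝ) (φ : ι → ℤ) (d : ℤ) :
    (∑ s ∈ S, ∑ t ∈ S, if φ s - φ t = -d then F (x s - x t) else 0) =
      ∑ s ∈ S, ∑ t ∈ S, if φ s - φ t = d then F (x s - x t) else 0 := by
  rw [Finset.sum_comm]
  refine Finset.sum_congr rfl fun s _ => Finset.sum_congr rfl fun t _ => ?_
  rw [← hFe (x s - x t), neg_sub]
  exact if_congr (by omega) rfl rfl

/-- Averaging a positive-definite function over a finite set labelled by integers gives a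
positive-definite function on an interval of `ℤ`. -/
theorem IsPosDefOn.isToeplitzGram_average {I : Set ℝ} {F : ℝ → ℝ} (hF : IsPosDefOn I F)
    (hFe : ∀ t, F (-t) = F t) {ι : Type*} (S : Finset ι) (x : ι → ℝ) (φ : ι → ℤ) (N : ℕ)
    (hx : ∀ s ∈ S, ∀ t ∈ S, |φ s - φ t| < N → x s - x t ∈ I) :
    IsToeplitzGram
      (fun d => (∑ s ∈ S, ∑ t ∈ S, if φ s - φ t = d then F (x s - x t) else 0) / S.card) N := by
  refine isToeplitzGram_of_forall_sum_nonneg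
    (fun d => congrArg (· / (S.card : ℝ)) (sum_ite_sub_eq_neg hFe S x φ d)) N fun α => ?_
  let Z : Finset ℤ := (Finset.univ ×ˢ S).image fun p : Fin N × ι => (p.1 : ℤ) - φ p.2
  let c : ℤ → ι → ℝ := fun z s => ∑ i : Fin N, if (i : ℤ) = z + φ s then α i else 0
  have hind (i j : Fin N) (s t : ι) (hs : s ∈ S) :
      (if φ s - φ t = (i : ℤ) - j then F (x s - x t) else 0) =
        ∑ z ∈ Z, if (i : ℤ) = z + φ s ∧ (j : ℤ) = z + φ t then F (x s - x t) else 0 := by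
    rw [Finset.sum_eq_single ((i : ℤ) - φ s)]
    · exact if_congr (by omega) rfl rfl
    · intro z _ hz
      exact if_neg (by omega)
    · intro h
      exact absurd (Finset.mem_image.mpr ⟨(i, s), by simp [hs], rfl⟩) h
  have hcc (z : ℤ) (s t : ι) : c z s * c z t * F (x s - x t) = ∑ i : Fin N, ∑ j : Fin N,
      α i * α j * if (i : ℤ) = z + φ s ∧ (j : ℤ) = z + φ t then F (x s - x t) else 0 := by
    simp only [c]
    rw [Finset.sum_mul_sum, Finset.sum_mul]
    refine Finset.sum_congr rfl fun i _ => ?_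
    rw [Finset.sum_mul]
    refine Finset.sum_congr rfl fun j _ => ?_
    by_cases h1 : (i : ℤ) = z + φ s <;> by_cases h2 : (j : ℤ) = z + φ t <;> simp [h1, h2]
  have hc0 (z : ℤ) (s : ι) (h : ¬(0 ≤ z + φ s ∧ z + φ s < N)) : c z s = 0 :=
    Finset.sum_eq_zero fun i _ => if_neg (by have := i.2; omega)
  have key : ∑ i, ∑ j, α i * α j *
      ((∑ s ∈ S, ∑ t ∈ S, if φ s - φ t = (i : ℤ) - j then F (x s - x t) else 0) / S.card) =
      (∑ z ∈ Z, ∑ s ∈ S, ∑ t ∈ S, c z s * c z t * F (x s - x t)) / S.card := by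
    simp only [← mul_div_assoc, ← Finset.sum_div]
    congr 1
    simp only [hcc]
    calc
      _ = ∑ i : Fin N, ∑ j : Fin N, ∑ z ∈ Z, ∑ s ∈ S, ∑ t ∈ S, α i * α j *
          if (i : ℤ) = z + φ s ∧ (j : ℤ) = z + φ t then F (x s - x t) else 0 := by
        refine Finset.sum_congr rfl fun i _ => Finset.sum_congr rfl fun j _ => ?_
        rw [sum_rotate, Finset.mul_sum]
        refine Finset.sum_congr rfl fun s hs => ?_
        rw [Finset.mul_sum]
        refine Finset.sum_congr rfl fun t _ => ?_
        rw [hind i j s t hs, Finset.mul_sum]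
      _ = ∑ z ∈ Z, ∑ i : Fin N, ∑ j : Fin N, ∑ s ∈ S, ∑ t ∈ S, α i * α j *
          if (i : ℤ) = z + φ s ∧ (j : ℤ) = z + φ t then F (x s - x t) else 0 :=
        (sum_rotate _ _ _ _).symm
      _ = _ := by
        refine Finset.sum_congr rfl fun z _ => ?_
        symm
        exact (Finset.sum_congr rfl fun i _ => sum_rotate _ _ _ _).trans (sum_rotate _ _ _ _)
  rw [key]
  refine div_nonneg (Finset.sum_nonneg fun z _ => ?_) (Nat.cast_nonneg _)
  have hfil (u : ι → ℝ) (hu : ∀ s, c z s = 0 → u s = 0) :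
      ∑ s ∈ S, u s = ∑ s ∈ S with 0 ≤ z + φ s ∧ z + φ s < N, u s :=
    (Finset.sum_filter_of_ne fun s _ hs => not_not.mp fun h => hs (hu s (hc0 z s h))).symm
  rw [hfil _ fun s hs => by simp [hs]]
  simp only [fun s => hfil (fun t => c z s * c z t * F (x s - x t)) fun t ht => by simp [ht]]
  refine hF.sum_finset_nonneg _ x (fun s hs t ht => ?_) (c z)
  rw [Finset.mem_filter] at hs ht
  exact hx s hs.1 t ht.1 (by rw [abs_lt]; omega)

/-- `ℤⁿ` is amenable: large boxes are almost invariant under finitely many translations. -/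
theorem exists_finset_almost_invariant {n : ℕ} (D : Finset (Fin n → ℤ)) {ε : ℝ} (hε : 0 < ε) :
    ∃ S : Finset (Fin n → ℤ), S.Nonempty ∧
      ∀ d ∈ D, (1 - ε) * S.card ≤ (S.filter fun s => s - d ∈ S).card := by
  obtain ⟨L, hL⟩ : ∃ L : ℕ, ∀ d ∈ D, ∀ i, |d i| ≤ L := by
    refine ⟨D.sup fun d => Finset.univ.sup fun i => (d i).natAbs, fun d hd i => ?_⟩
    have h1 : (d i).natAbs ≤ Finset.univ.sup fun i => (d i).natAbs :=
      Finset.le_sup (f := fun i => (d i).natAbs) (Finset.mem_univ i)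
    have h2 := h1.trans (Finset.le_sup (f := fun d => Finset.univ.sup fun i => (d i).natAbs) hd)
    rw [Int.abs_eq_natAbs]
    exact_mod_cast h2
  obtain ⟨R, hR⟩ := exists_nat_gt (2 * L * n / ε + 2 * L)
  have hR0 : (0 : ℝ) < R := lt_of_le_of_lt (by positivity) hR
  have hRL : 2 * (L : ℝ) < R := lt_of_le_of_lt (le_add_of_nonneg_left (by positivity)) hR
  have hRL' : 2 * L < R := by exact_mod_cast hRL
  refine ⟨Fintype.piFinset fun _ => Finset.Ico 0 (R : ℤ), ?_, fun d hd => ?_⟩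
  · rw [Fintype.piFinset_nonempty]
    exact fun _ => ⟨0, by simp; omega⟩
  · have hsub : (Fintype.piFinset fun _ : Fin n => Finset.Ico (L : ℤ) (R - L)) ⊆
        (Fintype.piFinset fun _ => Finset.Ico 0 (R : ℤ)).filter
          fun s => s - d ∈ Fintype.piFinset fun _ => Finset.Ico 0 (R : ℤ) := by
      intro s hs
      simp only [Finset.mem_filter, Fintype.mem_piFinset, Finset.mem_Ico, Pi.sub_apply] at hs ⊢
      refine ⟨fun i => ?_, fun i => ?_⟩ <;>
      · have := hs i
        have := abs_le.mp (hL d hd i)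
        omega
    have hcard := Finset.card_le_card hsub
    rw [Fintype.card_piFinset_const, Int.card_Ico] at hcard
    refine le_trans ?_ (Nat.cast_le.mpr hcard)
    rw [Fintype.card_piFinset_const, Int.card_Ico, sub_zero, Int.toNat_natCast,
      show ((R : ℤ) - L - L).toNat = R - 2 * L by omega]
    push_cast [hRL'.le]
    have h1 : (1 : ℝ) + n * (-(2 * L / R)) ≤ (1 + -(2 * L / R)) ^ n := by
      refine one_add_mul_le_pow ?_ n
      have : 2 * (L : ℝ) / R ≤ 1 := (div_le_one hR0).mpr hRL.le
      linarith
    have h2 : (n : ℝ) * (2 * L / R) ≤ ε := by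
      have : 2 * (L : ℝ) * n / ε < R := lt_of_le_of_lt (le_add_of_nonneg_right (by positivity)) hR
      rw [div_lt_iff₀ hε] at this
      rw [← mul_div_assoc, div_le_iff₀ hR0]
      linarith
    calc (1 - ε) * (R : ℝ) ^ n ≤ (1 + -(2 * L / R)) ^ n * (R : ℝ) ^ n := by
          gcongr
          linarith
      _ = ((R : ℝ) - 2 * L) ^ n := by
          rw [← mul_pow]
          congr 1
          field_simp
          ring

/-- On a finite set, an injective homomorphism `ℤⁿ → ℝ` can be replaced, up to scaling, by a
homomorphism to `ℤ` that separates the same points and has the same short vectors. -/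
theorem exists_int_hom_of_finset {n : ℕ} (π : (Fin n → ℤ) →+ ℝ) (hπ : Function.Injective π)
    (D : Finset (Fin n → ℤ)) {a : ℝ} (ha : 0 < a) :
    ∃ (φ : (Fin n → ℤ) →+ ℤ) (N : ℕ), 0 < N ∧
      ∀ d ∈ D, (φ d = 0 → d = 0) ∧ (|φ d| < N ↔ |π d| < a) := by
  classical
  let C : (Fin n → ℤ) → ℝ := fun d => ∑ i, |(d i : ℝ)|
  let φ : ℝ → (Fin n → ℤ) →+ ℤ := fun T =>
    { toFun := fun d => ∑ i, d i * round (T * π (Pi.single i 1))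
      map_zero' := by simp
      map_add' := fun d d' => by simp [add_mul, Finset.sum_add_distrib] }
  have hπd (d : Fin n → ℤ) : π d = ∑ i, d i * π (Pi.single i 1) := by
    conv_lhs => rw [← Finset.univ_sum_single d, map_sum]
    refine Finset.sum_congr rfl fun i _ => ?_
    rw [← zsmul_eq_mul, ← map_zsmul, ← Pi.single_smul, smul_eq_mul, mul_one]
  have hφ (T : ℝ) (d : Fin n → ℤ) : |(φ T d : ℝ) - T * π d| ≤ C d := by
    rw [hπd]
    simp only [φ, AddMonoidHom.coe_mk, ZeroHom.coe_mk, Int.cast_sum, Int.cast_mul, Finset.mul_sum,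
      ← Finset.sum_sub_distrib, C]
    refine (Finset.abs_sum_le_sum_abs _ _).trans (Finset.sum_le_sum fun i _ => ?_)
    rw [mul_left_comm, ← mul_sub, abs_mul, abs_sub_comm]
    exact mul_le_of_le_one_right (abs_nonneg _) ((abs_sub_round _).trans (by norm_num))
  obtain ⟨a', ⟨ha'0, ha'a⟩, ha'⟩ : ∃ a', (0 < a' ∧ a' < a) ∧ ∀ d ∈ D, |π d| < a → |π d| < a' := by
    have h : ∀ᶠ a' in nhdsWithin a (Set.Iio a), ∀ d ∈ D, |π d| < a → |π d| < a' := by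
      rw [Filter.eventually_all_finset]
      intro d _
      by_cases hd : |π d| < a
      · filter_upwards [Ioo_mem_nhdsLT hd] with a' h _ using h.1
      · exact Filter.Eventually.of_forall fun _ h => absurd h hd
    exact ((Filter.eventually_of_mem (Ioo_mem_nhdsLT ha) fun _ h => h).and h).exists
  have hlarge {r : ℝ} (hr : 0 < r) (c : ℝ) : ∀ᶠ T : ℝ in Filter.atTop, c < T * r :=
    (Filter.tendsto_id.atTop_mul_const hr).eventually_gt_atTop c
  have hT : ∀ᶠ T in Filter.atTop, ∀ d ∈ D, (d ≠ 0 → C d < T * |π d|) ∧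
      (|π d| < a' → C d < T * (a' - |π d|)) ∧ C d + 1 < T * (a - a') := by
    rw [Filter.eventually_all_finset]
    intro d _
    refine Filter.Eventually.and ?_ (Filter.Eventually.and ?_ (hlarge (sub_pos.mpr ha'a) _))
    · by_cases hd : d = 0
      · exact Filter.Eventually.of_forall fun _ h => absurd hd h
      · filter_upwards [hlarge (abs_pos.mpr ((map_ne_zero_iff π hπ).mpr hd)) (C d)] with
          T h _ using h
    · by_cases hd : |π d| < a'
      · filter_upwards [hlarge (sub_pos.mpr hd) (C d)] with T h _ using h
      · exact Filter.Eventually.of_forall fun _ h => absurd h hd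
  obtain ⟨T, hT, hT0⟩ := (hT.and (Filter.eventually_gt_atTop 0)).exists
  have hTa : 0 < T * a' := mul_pos hT0 ha'0
  refine ⟨φ T, ⌈T * a'⌉₊, Nat.ceil_pos.mpr hTa, fun d hd => ?_⟩
  obtain ⟨h1, h2, h3⟩ := hT d hd
  have habs : |T * π d| = T * |π d| := by rw [abs_mul, abs_of_pos hT0]
  have hup : |(φ T d : ℝ)| ≤ T * |π d| + C d := by
    have := abs_sub_abs_le_abs_sub (φ T d : ℝ) (T * π d)
    have := hφ T d
    linarith
  have hlow : T * |π d| - C d ≤ |(φ T d : ℝ)| := by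
    have := abs_sub_abs_le_abs_sub (T * π d) (φ T d : ℝ)
    rw [abs_sub_comm] at this
    have := hφ T d
    linarith
  have hN1 := Nat.le_ceil (T * a')
  have hN2 := Nat.ceil_lt_add_one hTa.le
  refine ⟨fun h => ?_, fun h => ?_, fun h => ?_⟩
  · by_contra hd0
    have := h1 hd0
    rw [h, Int.cast_zero, abs_zero] at hlow
    linarith
  · by_contra! hge
    have h' : |(φ T d : ℝ)| < ⌈T * a'⌉₊ := by exact_mod_cast h
    have := mul_le_mul_of_nonneg_left hge hT0.le
    linarith
  · have h' : |(φ T d : ℝ)| < ⌈T * a'⌉₊ := by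
      have := h2 (ha' d hd h)
      linarith
    exact_mod_cast h'

theorem exists_lattice_of_finset (X : Finset ℝ) :
    ∃ (n : ℕ) (π : (Fin n → ℤ) →+ ℝ), Function.Injective π ∧ ∀ x ∈ X, ∃ v, π v = x := by
  obtain ⟨n, b⟩ := Module.basisOfFiniteTypeTorsionFree' (R := ℤ)
    (M := Submodule.span ℤ (X : Set ℝ))
  refine ⟨n, ((Submodule.subtype _).comp b.equivFun.symm.toLinearMap).toAddMonoidHom,
    Subtype.val_injective.comp b.equivFun.symm.injective, fun x hx =>
    ⟨b.equivFun ⟨x, Submodule.subset_span hx⟩, ?_⟩⟩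
  simp

open scoped Pointwise in
/-- On every finite set of differences, an even function positive-definite on `(-a, a)` is
approximated by functions that are positive-definite on the whole finite set. -/
theorem IsPosDefOn.exists_approx_on_finset {a : ℝ} (ha : 0 < a) {F : ℝ → ℝ}
    (hF : IsPosDefOn (Set.Ioo (-a) a) F) (hFe : ∀ t, F (-t) = F t) (X : Finset ℝ) {ε : ℝ}
    (hε : 0 < ε) :
    ∃ G : ℝ → ℝ, (∀ t, G (-t) = G t) ∧
      (∀ (k : ℕ) (x α : Fin k → ℝ), (∀ i, x i ∈ X) →
        0 ≤ ∑ i, ∑ j, α i * α j * G (x i - x j)) ∧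
      ∀ x ∈ X, ∀ y ∈ X, |x - y| < a → |G (x - y) - F (x - y)| ≤ ε * |F (x - y)| := by
  obtain ⟨n, π, hπ, hX⟩ := exists_lattice_of_finset X
  choose! p hp using hX
  let P := X.image p
  obtain ⟨S, hS, hSP⟩ := exists_finset_almost_invariant (P - P) hε
  let D := (P - P) ∪ (S - S)
  obtain ⟨φ, N, hN, hφ⟩ := exists_int_hom_of_finset π hπ (D ∪ (D - D)) ha
  have hgram := hF.isToeplitzGram_average hFe S π φ N fun s hs t ht h => by
    rw [← map_sub] at h ⊢
    exact abs_lt.mp (((hφ _ (Finset.mem_union_left _ (Finset.mem_union_right _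
      (Finset.sub_mem_sub hs ht)))).2).mp h)
  obtain ⟨K, hK⟩ : ∃ K : ℕ, ∀ x ∈ X, |φ (p x)| ≤ K := by
    refine ⟨X.sup fun x => (φ (p x)).natAbs, fun x hx => ?_⟩
    have := Finset.le_sup (f := fun x => (φ (p x)).natAbs) hx
    rw [Int.abs_eq_natAbs]
    exact_mod_cast this
  obtain ⟨g, hge, hgf, hgg⟩ := hgram.exists_extension
    (fun d => congrArg (· / (S.card : ℝ)) (sum_ite_sub_eq_neg hFe S π φ d)) hN (2 * K)
  let G : ℝ → ℝ := fun t => g (φ (Function.invFun π t))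
  have hG (v : Fin n → ℤ) : G (π v) = g (φ v) := by
    simp only [G, Function.leftInverse_invFun hπ v]
  have hGX {x y : ℝ} (hx : x ∈ X) (hy : y ∈ X) : G (x - y) = g (φ (p x) - φ (p y)) := by
    rw [← map_sub φ, ← hG, map_sub, hp x hx, hp y hy]
  refine ⟨G, fun t => ?_, fun k x α hx => ?_, fun x hx y hy hxy => ?_⟩
  · by_cases ht : ∃ v, π v = t
    · obtain ⟨v, rfl⟩ := ht
      rw [← map_neg, hG, hG, map_neg, hge]
    · have ht' : ¬∃ v, π v = -t := fun ⟨v, hv⟩ => ht ⟨-v, by rw [map_neg, hv, neg_neg]⟩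
      simp only [G, Function.invFun_neg ht, Function.invFun_neg ht']
  · simp only [fun i j => hGX (hx i) (hx j)]
    refine hgg.sum_nonneg (fun i => φ (p (x i))) K (fun i => ?_) (fun i => ?_) α
    · have := (abs_le.mp (hK _ (hx i))).1
      omega
    · have := (abs_le.mp (hK _ (hx i))).2
      push_cast
      omega
  · have hdP : p x - p y ∈ P - P :=
      Finset.sub_mem_sub (Finset.mem_image_of_mem p hx) (Finset.mem_image_of_mem p hy)
    have hdD : p x - p y ∈ D := Finset.mem_union_left _ hdP
    have hπd : π (p x - p y) = x - y := by rw [map_sub, hp x hx, hp y hy]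
    have hlt : |φ (p x) - φ (p y)| < N := by
      rw [← map_sub, (hφ _ (Finset.mem_union_left _ hdD)).2, hπd]
      exact hxy
    have hiff (s : Fin n → ℤ) (hs : s ∈ S) (t : Fin n → ℤ) (ht : t ∈ S) :
        φ s - φ t = φ (p x) - φ (p y) ↔ s - (p x - p y) = t := by
      constructor
      · intro h
        have := (hφ _ (Finset.mem_union_right _ (Finset.sub_mem_sub
          (Finset.mem_union_right _ (Finset.sub_mem_sub hs ht)) hdD))).1
          (by rw [map_sub, map_sub, map_sub, h, sub_self])
        rw [sub_eq_zero] at this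
        rw [← this, sub_sub_cancel]
      · rintro rfl
        rw [map_sub, map_sub]
        abel
    have hsum : (∑ s ∈ S, ∑ t ∈ S,
        if φ s - φ t = φ (p x) - φ (p y) then F (π s - π t) else 0) =
        (S.filter fun s => s - (p x - p y) ∈ S).card * F (x - y) := by
      rw [← nsmul_eq_mul, ← Finset.sum_const, Finset.sum_filter]
      refine Finset.sum_congr rfl fun s hs => ?_
      rw [← Finset.sum_ite_eq S (s - (p x - p y)) fun _ => F (x - y)]
      refine Finset.sum_congr rfl fun t ht => ?_
      simp only [hiff s hs t ht]
      split_ifs with h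
      · rw [← h, ← map_sub, sub_sub_cancel, hπd]
      · rfl
    have hcard : (0 : ℝ) < S.card := Nat.cast_pos.mpr hS.card_pos
    rw [hGX hx hy, hgf _ hlt, hsum, mul_div_right_comm, ← sub_one_mul, abs_mul]
    refine mul_le_mul_of_nonneg_right ?_ (abs_nonneg _)
    have h1 : ((S.filter fun s => s - (p x - p y) ∈ S).card : ℝ) / S.card ≤ 1 :=
      div_le_one_of_le₀ (Nat.cast_le.mpr (Finset.card_filter_le _ _)) hcard.le
    have h2 := (le_div_iff₀ hcard).mpr (hSP _ hdP)
    rw [abs_le]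
    constructor <;> linarith

/-- An even function positive-definite on `(-a, a)` extends to a positive-definite function
on `ℝ`. -/
theorem IsPosDefOn.exists_extension_univ_of_even {a : ℝ} (ha : 0 < a) {F : ℝ → ℝ}
    (hF : IsPosDefOn (Set.Ioo (-a) a) F) (hFe : ∀ t, F (-t) = F t) :
    ∃ G : ℝ → ℝ, IsPosDefOn Set.univ G ∧ ∀ t ∈ Set.Ioo (-a) a, G t = F t := by
  choose G hGe hGpos hGF using fun X : Finset ℝ =>
    hF.exists_approx_on_finset ha hFe X (Nat.one_div_pos_of_nat (α := ℝ) (n := X.card))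
  let 𝒰 : Ultrafilter (Finset ℝ) := Ultrafilter.of Filter.atTop
  have h𝒰 : (𝒰 : Filter (Finset ℝ)) ≤ Filter.atTop := Ultrafilter.of_le _
  have hmem (t : ℝ) : ∀ᶠ X in (𝒰 : Filter (Finset ℝ)), t ∈ X := by
    filter_upwards [h𝒰 (Filter.eventually_ge_atTop {t})] with X hX
    exact hX (Finset.mem_singleton_self t)
  have hbound (t : ℝ) : ∀ᶠ X in (𝒰 : Filter (Finset ℝ)),
      G X t ∈ Set.Icc (-(2 * |F 0|)) (2 * |F 0|) := by
    filter_upwards [hmem t, hmem 0] with X ht h0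
    have hx (i : Fin 2) : (![t, 0] : Fin 2 → ℝ) i ∈ X := by fin_cases i <;> simpa
    have h1 := hGpos X 2 ![t, 0] ![1, 1] hx
    have h2 := hGpos X 2 ![t, 0] ![1, -1] hx
    have h3 := hGF X 0 h0 0 h0 (by simpa using ha)
    simp [Fin.sum_univ_two, hGe] at h1 h2
    rw [sub_zero] at h3
    have h4 : 1 / ((X.card : ℝ) + 1) ≤ 1 :=
      div_le_one_of_le₀ (le_add_of_nonneg_left (Nat.cast_nonneg _)) (by positivity)
    have h5 := (abs_le.mp (h3.trans (mul_le_mul_of_nonneg_right h4 (abs_nonneg _)))).2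
    have h6 := le_abs_self (F 0)
    constructor <;> linarith
  have hlim (t : ℝ) : ∃ l, Filter.Tendsto (fun X => G X t) 𝒰 (nhds l) := by
    obtain ⟨l, -, hl⟩ := isCompact_iff_ultrafilter_le_nhds.mp
      (isCompact_Icc (a := -(2 * |F 0|)) (b := 2 * |F 0|)) (𝒰.map fun X => G X t)
      (Filter.le_principal_iff.mpr (hbound t))
    exact ⟨l, hl⟩
  choose L hL using hlim
  refine ⟨L, fun n x α _ => ?_, fun t ht => ?_⟩
  · refine ge_of_tendsto (tendsto_finsetSum _ fun i _ => tendsto_finsetSum _ fun j _ =>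
      (hL (x i - x j)).const_mul (α i * α j)) ?_
    filter_upwards [Filter.eventually_all.mpr fun i => hmem (x i)] with X hX
    exact hGpos X n x α hX
  · have h0 : Filter.Tendsto (fun X : Finset ℝ => 1 / ((X.card : ℝ) + 1) * |F t|) 𝒰 (nhds 0) := by
      have := ((tendsto_one_div_add_atTop_nhds_zero_nat (𝕜 := ℝ)).comp
        (Filter.tendsto_card_atTop_atTop (α := ℝ))).mul_const |F t|
      rw [zero_mul] at this
      exact this.mono_left h𝒰
    refine tendsto_nhds_unique (hL t) (tendsto_iff_norm_sub_tendsto_zero.mpr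
      (squeeze_zero' (Filter.Eventually.of_forall fun _ => norm_nonneg _) ?_ h0))
    filter_upwards [hmem t, hmem 0] with X hXt hX0
    have := hGF X t hXt 0 hX0 (by rw [sub_zero]; exact abs_lt.mpr ht)
    rwa [sub_zero] at this

theorem sum_mul_mul_odd_eq_zero {H : ℝ → ℝ} (hH : ∀ t, H (-t) = -H t) {n : ℕ} (x α : Fin n → ℝ) :
    ∑ i, ∑ j, α i * α j * H (x i - x j) = 0 := by
  have h : ∑ i, ∑ j, α i * α j * H (x i - x j) = -∑ i, ∑ j, α i * α j * H (x i - x j) := by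
    conv_lhs => rw [Finset.sum_comm]
    simp only [← Finset.sum_neg_distrib]
    refine Finset.sum_congr rfl fun i _ => Finset.sum_congr rfl fun j _ => ?_
    rw [← neg_sub (x i), hH]
    ring
  linarith

/-- Positive-definiteness only depends on the even part of a function. -/
theorem isPosDefOn_add_odd_iff {I : Set ℝ} {F H : ℝ → ℝ} (hH : ∀ t, H (-t) = -H t) :
    IsPosDefOn I (F + H) ↔ IsPosDefOn I F := by
  simp only [IsPosDefOn, Pi.add_apply, mul_add, Finset.sum_add_distrib,
    sum_mul_mul_odd_eq_zero hH, add_zero]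

/-- Every function positive-definite on `(-a, a)` extends to a function positive-definite on
`(-2a, 2a)`. -/
theorem posdef_extension_double (a : ℝ) (ha : 0 < a) (F : ℝ → ℝ)
    (hF : IsPosDefOn (Set.Ioo (-a) a) F) :
    ∃ G : ℝ → ℝ, IsPosDefOn (Set.Ioo (-(2 * a)) (2 * a)) G ∧
      ∀ t ∈ Set.Ioo (-a) a, G t = F t := by
  let E : ℝ → ℝ := fun t => (F t + F (-t)) / 2
  let H : ℝ → ℝ := fun t => (F t - F (-t)) / 2
  have hH (t : ℝ) : H (-t) = -H t := by simp only [H, neg_neg]; ring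
  have hFEH : F = E + H := by ext t; simp only [E, H, Pi.add_apply]; ring
  rw [hFEH, isPosDefOn_add_odd_iff hH] at hF
  obtain ⟨G, hG, hGE⟩ :=
    hF.exists_extension_univ_of_even ha fun t => by simp only [E, neg_neg, add_comm]
  refine ⟨G + H, (isPosDefOn_add_odd_iff hH).mpr fun n x α _ => hG n x α fun _ _ => trivial,
    fun t ht => ?_⟩
  rw [hFEH, Pi.add_apply, Pi.add_apply, hGE t ht]
end
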